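/- arXiv:1511.09470 — 3 statements merged into one kernel-verified Lean document; each statement's English description precedes it below -/
import Mathlib

section
/- Let g : ℝ → ℂ be a continuous Wiener-space function with ĝ = i·g (eigenfunction of the Fourier transform with eigenvalue i; such g is automatically odd). Then for each s ∈ {2,3,4} and each p ∈ {0,1,…,s−1}, ∑_{k∈ℤ} g(√s·(k + p/s)) = 0. -/
open MeasureTheory Complex Real FourierTransform

/-- The Zak transform `Z_λ f (x, γ) = √λ ∑_{k∈ℤ} f(λ(x+k)) e^{-2πikγ}`. -/
noncomputable def zak (lam : ℝ) (f : ℝ → ℂ) (x γ : ℝ) : ℂ :=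
  (Real.sqrt lam : ℂ) *
    ∑' k : ℤ, f (lam * (x + k)) * Complex.exp (-2 * Real.pi * Complex.I * k * γ)

/-- Membership in the Wiener space `W(ℝ)`:
`∑_{k∈ℤ} sup_{x∈[0,1]} |f(x+k)| < ∞`. -/
def InWiener (f : ℝ → ℂ) : Prop :=
  Summable (fun k : ℤ => ⨆ x : Set.Icc (0:ℝ) 1, ‖f ((x : ℝ) + k)‖)

/-- The least upper bound of `‖f‖` over the interval `[n, n + 1]`. -/
noncomputable def unitSup (f : ℝ → ℂ) (n : ℤ) : ℝ :=
  ⨆ x : Set.Icc (0 : ℝ) 1, ‖f ((x : ℝ) + n)‖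

lemma unitSup_nonneg (f : ℝ → ℂ) (n : ℤ) : 0 ≤ unitSup f n :=
  Real.iSup_nonneg fun _ => norm_nonneg _

lemma norm_le_unitSup_floor {f : ℝ → ℂ} (hf : Continuous f) (y : ℝ) :
    ‖f y‖ ≤ unitSup f ⌊y⌋ := by
  have hb : BddAbove (Set.range fun x : Set.Icc (0 : ℝ) 1 => ‖f ((x : ℝ) + ⌊y⌋)‖) :=
    (isCompact_range (by fun_prop)).bddAbove
  have h := le_ciSup hb ⟨Int.fract y, Int.fract_nonneg y, (Int.fract_lt_one y).le⟩
  simpa [unitSup, Int.fract_add_floor] using h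

lemma injective_floor_mul_intCast {a : ℝ} (ha : 1 ≤ a) :
    Function.Injective fun n : ℤ => ⌊a * n⌋ := by
  refine StrictMono.injective fun m n hmn => ?_
  have h : (m : ℝ) + 1 ≤ n := by exact_mod_cast hmn
  have h1 : a * m + 1 ≤ a * n := by nlinarith
  have h2 := Int.floor_le_floor h1
  rw [Int.floor_add_one] at h2
  show ⌊a * m⌋ < ⌊a * n⌋
  omega

/-- For a Wiener-space function, the dilate by `a ≥ 1` has absolutely and locally uniformly
convergent periodization. -/
lemma InWiener.summable_norm_restrict {f : ℝ → ℂ} (hf : Continuous f) (hW : InWiener f)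
    {a : ℝ} (ha : 1 ≤ a) (F : C(ℝ, ℂ)) (hF : ∀ x, F x = f (a * x))
    (K : TopologicalSpace.Compacts ℝ) :
    Summable fun n : ℤ => ‖(F.comp (ContinuousMap.addRight (n : ℝ))).restrict K‖ := by
  obtain ⟨R, hR⟩ := K.isCompact.isBounded.exists_norm_le
  set N : ℤ := ⌈a * R⌉ + 1
  have hs : Summable fun n : ℤ => ∑ j ∈ Finset.Icc (-N) N, unitSup f (⌊a * n⌋ + j) := by
    refine summable_sum fun j _ => ?_
    have hinj : Function.Injective fun n : ℤ => ⌊a * n⌋ + j :=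
      (add_left_injective j).comp (injective_floor_mul_intCast ha)
    exact Summable.comp_injective (f := unitSup f) hW hinj
  refine hs.of_nonneg_of_le (fun _ => norm_nonneg _) fun n => ?_
  refine (ContinuousMap.norm_le _ (Finset.sum_nonneg fun _ _ => unitSup_nonneg _ _)).2 ?_
  rintro ⟨x, hx⟩
  have hxR := abs_le.1 (hR x hx)
  have hN : a * R ≤ ⌈a * R⌉ := Int.le_ceil _
  have e1 := Int.floor_le (a * (x + n))
  have e2 := Int.lt_floor_add_one (a * (x + n))
  have e3 := Int.floor_le (a * n)
  have e4 := Int.lt_floor_add_one (a * n)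
  have hax1 : a * x ≤ a * R := by nlinarith
  have hax2 : -(a * R) ≤ a * x := by nlinarith
  have hmem : ⌊a * (x + n)⌋ - ⌊a * n⌋ ∈ Finset.Icc (-N) N := by
    have h1 : -((N : ℤ) : ℝ) ≤ ⌊a * (x + n)⌋ - ⌊a * n⌋ := by
      simp only [N]; push_cast; linarith
    have h2 : (⌊a * (x + n)⌋ : ℝ) - ⌊a * n⌋ ≤ (N : ℤ) := by
      simp only [N]; push_cast; linarith
    exact Finset.mem_Icc.2 ⟨by exact_mod_cast h1, by exact_mod_cast h2⟩
  calc ‖((F.comp (ContinuousMap.addRight (n : ℝ))).restrict K) ⟨x, hx⟩‖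
      = ‖f (a * (x + n))‖ := congrArg norm (hF (x + n))
    _ ≤ unitSup f (⌊a * n⌋ + (⌊a * (x + n)⌋ - ⌊a * n⌋)) := by
      rw [add_sub_cancel]; exact norm_le_unitSup_floor hf _
    _ ≤ _ := Finset.single_le_sum (f := fun j => unitSup f (⌊a * n⌋ + j))
      (fun _ _ => unitSup_nonneg _ _) hmem

lemma fourier_comp_mul_left (f : ℝ → ℂ) {a : ℝ} (ha : 0 < a) (w : ℝ) :
    𝓕 (fun x => f (a * x)) w = (a : ℂ)⁻¹ * 𝓕 f (w / a) := by
  rw [Real.fourier_real_eq_integral_exp_smul, Real.fourier_real_eq_integral_exp_smul]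
  have h := Measure.integral_comp_mul_left
    (fun v : ℝ => Complex.exp (↑(-2 * π * v * (w / a)) * Complex.I) • f v) a
  rw [abs_of_pos (inv_pos.2 ha), Complex.real_smul, Complex.ofReal_inv] at h
  rw [← h]
  congr 1 with x
  congr 4
  field_simp

lemma summable_of_summable_residues {E : Type*} [NormedAddCommGroup E] [CompleteSpace E]
    (s : ℕ) [NeZero s] {h : ℤ → E}
    (hs : ∀ q : Fin s, Summable fun k : ℤ => ‖h (k * s + (q : ℕ))‖) :
    Summable h ∧ ∑' n, h n = ∑ q : Fin s, ∑' k : ℤ, h (k * s + (q : ℕ)) := by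
  let e : Fin s × ℤ ≃ ℤ := (Equiv.prodComm _ _).trans (Int.divModEquiv s).symm
  have he : ∀ x, e x = x.2 * s + (x.1 : ℕ) := fun x => by
    simp [e, Int.divModEquiv]
  have hsum : Summable fun x : Fin s × ℤ => h (e x) := by
    refine Summable.of_norm ((summable_prod_of_nonneg fun _ => norm_nonneg _).2 ⟨?_, ?_⟩)
    · intro q; simpa [he] using hs q
    · exact (hasSum_fintype _).summable
  refine ⟨e.summable_iff.1 hsum, ?_⟩
  rw [← e.tsum_eq h, hsum.tsum_prod' fun q => ?_, tsum_fintype]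
  · simp [he]
  · simpa [he] using (hs q).of_norm

/-- The samples `∑ k, g (√s (k + p / s))` of an eigenfunction of the Fourier transform with
eigenvalue `i` satisfy a finite Fourier eigenvalue equation. -/
lemma tsum_sqrt_dilate_eq {g : ℝ → ℂ} (hg : Continuous g) (hW : InWiener g)
    (heig : ∀ γ : ℝ, 𝓕 g γ = Complex.I * g γ) (s : ℕ) [NeZero s] (p : ℕ) :
    ∑' k : ℤ, g (√s * ((k : ℝ) + (p : ℝ) / s)) =
      Complex.I / (√s : ℝ) * ∑ q : Fin s, Complex.exp (2 * π * Complex.I / s) ^ ((q : ℕ) * p) *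
        ∑' k : ℤ, g (√s * ((k : ℝ) + ((q : ℕ) : ℝ) / s)) := by
  have hs1 : (1 : ℝ) ≤ s := by exact_mod_cast NeZero.one_le
  have hs0 : (0 : ℝ) < s := by linarith
  have ha : 1 ≤ √(s : ℝ) := Real.one_le_sqrt.2 hs1
  have ha0 : 0 < √(s : ℝ) := by linarith
  let F : C(ℝ, ℂ) := ⟨fun x => g (√s * x), by fun_prop⟩
  have hnorm := hW.summable_norm_restrict hg ha F fun _ => rfl
  have hpt : ∀ x : ℝ, Summable fun k : ℤ => ‖g (√s * (k + x))‖ := fun x => by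
    refine (hnorm ⟨{x}, isCompact_singleton⟩).of_nonneg_of_le (fun _ => norm_nonneg _) fun k => ?_
    have := ((F.comp (ContinuousMap.addRight (k : ℝ))).restrict {x}).norm_coe_le_norm ⟨x, rfl⟩
    rw [add_comm]
    exact this
  have hF : ∀ n : ℤ, 𝓕 (F : ℝ → ℂ) n = Complex.I / (√s : ℝ) * g (n / √s) := fun n => by
    have := fourier_comp_mul_left g ha0 n
    rw [heig] at this
    rw [show (F : ℝ → ℂ) = fun x => g (√s * x) from rfl, this]
    ring
  have harg : ∀ (k : ℤ) (q : ℕ), ((k * s + q : ℤ) : ℝ) / √s = √s * (k + (q : ℝ) / s) := by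
    intro k q
    field_simp
    push_cast
    rw [Real.sq_sqrt hs0.le]
    ring
  have hsum : Summable fun n : ℤ => 𝓕 (F : ℝ → ℂ) n := by
    refine (summable_of_summable_residues s fun q => ?_).1
    simp_rw [hF, harg, norm_mul]
    exact (hpt _).mul_left _
  have hpois := Real.tsum_eq_tsum_fourier hnorm hsum ((p : ℝ) / s)
  have hphase : ∀ (k : ℤ) (q : ℕ),
      (fourier (k * s + q : ℤ) (((p : ℝ) / s : ℝ) : UnitAddCircle) : ℂ) =
        Complex.exp (2 * π * Complex.I / s) ^ (q * p) := by
    intro k q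
    have hsC : (s : ℂ) ≠ 0 := by exact_mod_cast hs0.ne'
    rw [fourier_coe_apply, ← Complex.exp_nat_mul, Complex.exp_eq_exp_iff_exists_int]
    refine ⟨k * p, ?_⟩
    push_cast
    field_simp
    ring
  have hsplit := (summable_of_summable_residues s
    (h := fun n : ℤ => 𝓕 (F : ℝ → ℂ) n * fourier n (((p : ℝ) / s : ℝ) : UnitAddCircle))
    fun q => by
      simp_rw [hF, harg, hphase, norm_mul]
      exact ((hpt _).mul_left _).mul_right _).2
  simp_rw [hF (_ * _ + _), harg, hphase] at hsplit
  calc _ = ∑' n : ℤ, F ((p : ℝ) / s + n) := tsum_congr fun k => by rw [add_comm]; rfl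
    _ = _ := by
      rw [hpois, hsplit, Finset.mul_sum]
      refine Finset.sum_congr rfl fun q _ => ?_
      rw [tsum_mul_right, tsum_mul_left]
      ring

lemma eq_zero_of_dft_two {T : ℕ → ℂ}
    (hT : ∀ p, T p = Complex.I / (√(2 : ℕ) : ℝ) * ∑ q : Fin 2,
      Complex.exp (2 * π * Complex.I / (2 : ℕ)) ^ ((q : ℕ) * p) * T q) :
    ∀ p < 2, T p = 0 := by
  have hw : Complex.exp (2 * π * Complex.I / (2 : ℕ)) = -1 := by
    rw [← Complex.exp_pi_mul_I]; congr 1; push_cast; ring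
  rw [hw] at hT
  obtain ⟨c, hc⟩ : ∃ c : ℂ, c = Complex.I / (√(2 : ℕ) : ℝ) := ⟨_, rfl⟩
  have hc2 : c ^ 2 = -1 / 2 := by
    rw [hc, div_pow, Complex.I_sq, ← Complex.ofReal_pow, Real.sq_sqrt (by positivity)]
    norm_num
  rw [← hc] at hT
  have e0 := hT 0
  have e1 := hT 1
  simp only [Fin.sum_univ_two, Fin.val_zero, Fin.val_one] at e0 e1
  have h0 : T 0 = 0 := by linear_combination (1 / 2 + c / 2) * e0 + c / 2 * e1 + T 0 * hc2
  have h1 : T 1 = 0 := by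
    linear_combination c / 2 * e0 + (1 / 2 - c / 2) * e1 + T 1 * hc2
  intro p hp
  interval_cases p <;> assumption

lemma eq_zero_of_dft_three {T : ℕ → ℂ}
    (hT : ∀ p, T p = Complex.I / (√(3 : ℕ) : ℝ) * ∑ q : Fin 3,
      Complex.exp (2 * π * Complex.I / (3 : ℕ)) ^ ((q : ℕ) * p) * T q) :
    ∀ p < 3, T p = 0 := by
  have hr : ((√3 : ℝ) : ℂ) ^ 2 = 3 := by
    rw [← Complex.ofReal_pow, Real.sq_sqrt (by positivity)]; norm_num
  have hr0 : ((√3 : ℝ) : ℂ) ≠ 0 := by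
    intro h; rw [h] at hr; norm_num at hr
  obtain ⟨w, hw⟩ : ∃ w, w = Complex.exp (2 * π * Complex.I / (3 : ℕ)) := ⟨_, rfl⟩
  have hwv : w = -1 / 2 + (√3 : ℝ) / 2 * Complex.I := by
    have h : (2 * π * Complex.I / (3 : ℕ) : ℂ) = ((π - π / 3 : ℝ) : ℂ) * Complex.I := by
      push_cast; ring
    rw [hw, h, Complex.exp_mul_I, ← Complex.ofReal_cos, ← Complex.ofReal_sin, Real.cos_pi_sub,
      Real.sin_pi_sub, Real.cos_pi_div_three, Real.sin_pi_div_three]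
    push_cast
    ring
  obtain ⟨c, hc⟩ : ∃ c : ℂ, c = Complex.I / (√(3 : ℕ) : ℝ) := ⟨_, rfl⟩
  rw [← hc, ← hw] at hT
  push_cast at hc
  have hcr : c * (√3 : ℝ) = Complex.I := by rw [hc]; field_simp
  have hc2 : c ^ 2 = -1 / 3 := by
    rw [hc, div_pow, Complex.I_sq, hr]
  have hc0 : c ≠ 0 := by
    intro h; rw [h] at hc2; norm_num at hc2
  have hw2 : w ^ 2 + w + 1 = 0 := by
    rw [hwv]; linear_combination (1 / 4) * Complex.I ^ 2 * hr + (3 / 4) * Complex.I_sq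
  have hcw : c * (w - w ^ 2) = -1 := by
    have h : w - w ^ 2 = (√3 : ℝ) * Complex.I := by linear_combination 2 * hwv - hw2
    rw [h]; linear_combination Complex.I * hcr + Complex.I_sq
  have hw4 : w ^ 4 = w := by linear_combination (w ^ 2 - w) * hw2
  have e0 := hT 0
  have e1 := hT 1
  have e2 := hT 2
  simp only [Fin.sum_univ_three, Fin.val_zero, Fin.val_one, Fin.val_two, zero_mul, one_mul,
    mul_zero, mul_one, pow_zero, pow_one, Nat.reduceMul, hw4] at e0 e1 e2
  have h0 : T 0 = 0 := by
    linear_combination (1 / 2 + c / 2) * e0 + c / 2 * e1 + c / 2 * e2 + 3 / 2 * T 0 * hc2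
      + c ^ 2 / 2 * (T 1 + T 2) * hw2
  have h12 : T 1 + T 2 = 0 := by
    rw [h0, zero_add] at e0
    exact (mul_eq_zero.1 e0.symm).resolve_left hc0 |> fun h => by linear_combination h
  have h1 : T 1 = 0 := by
    linear_combination (1 / 2) * e1 + c / 2 * h0 + c / 2 * w ^ 2 * h12 + T 1 / 2 * hcw
  have h2 : T 2 = 0 := by linear_combination h12 - h1
  intro p hp
  interval_cases p <;> assumption

lemma eq_zero_of_dft_four {T : ℕ → ℂ}
    (hT : ∀ p, T p = Complex.I / (√(4 : ℕ) : ℝ) * ∑ q : Fin 4,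
      Complex.exp (2 * π * Complex.I / (4 : ℕ)) ^ ((q : ℕ) * p) * T q) :
    ∀ p < 4, T p = 0 := by
  have hw : Complex.exp (2 * π * Complex.I / (4 : ℕ)) = Complex.I := by
    rw [show (2 * π * Complex.I / (4 : ℕ) : ℂ) = π / 2 * Complex.I by push_cast; ring,
      Complex.exp_pi_div_two_mul_I]
  have hr : √((4 : ℕ) : ℝ) = 2 := by
    rw [Real.sqrt_eq_iff_mul_self_eq] <;> norm_num
  rw [hw, hr] at hT
  have hI := Complex.I_sq
  have hI3 : Complex.I ^ 3 = -Complex.I := by linear_combination Complex.I * hI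
  have hI4 : Complex.I ^ 4 = 1 := by linear_combination (Complex.I ^ 2 - 1) * hI
  have hI6 : Complex.I ^ 6 = -1 := by linear_combination Complex.I ^ 2 * hI4 + hI
  have hI9 : Complex.I ^ 9 = Complex.I := by
    linear_combination (Complex.I ^ 5 + Complex.I) * hI4
  have hv3 : ((3 : Fin 4) : ℕ) = 3 := rfl
  have e0 := hT 0
  have e1 := hT 1
  have e2 := hT 2
  have e3 := hT 3
  simp only [Fin.sum_univ_four, Fin.val_zero, Fin.val_one, Fin.val_two, hv3, zero_mul,
    one_mul, mul_zero, mul_one, pow_zero, pow_one, Nat.reduceMul, hI, hI3, hI4, hI6, hI9,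
    Complex.ofReal_ofNat] at e0 e1 e2 e3
  have h0 : T 0 = 0 := by
    linear_combination (1 / 2) * e0 + Complex.I / 4 * (e0 + e1 + e2 + e3) + T 0 / 2 * hI
  have h2 : T 2 = 0 := by
    linear_combination (1 / 2) * e2 + Complex.I / 4 * (e0 - e1 + e2 - e3) + T 2 / 2 * hI
  have h13 : T 1 + T 3 = 0 := by
    linear_combination e1 + e3 + Complex.I * h0 - Complex.I * h2
  have h1 : T 1 = 0 := by
    linear_combination (1 / 2) * e1 + Complex.I / 4 * h0 - Complex.I / 4 * h2
      - Complex.I ^ 2 / 4 * h13 + T 1 / 2 * hI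
  have h3 : T 3 = 0 := by linear_combination h13 - h1
  intro p hp
  interval_cases p <;> assumption

theorem sum_eigen_i (g : ℝ → ℂ) (hg : Continuous g) (hW : InWiener g)
    (heig : ∀ γ : ℝ, 𝓕 g γ = Complex.I * g γ) :
    ∀ s ∈ ({2, 3, 4} : Set ℕ), ∀ p < s,
      ∑' k : ℤ, g (Real.sqrt s * ((k : ℝ) + (p : ℝ) / s)) = 0 := by
  have key (s : ℕ) [NeZero s] := tsum_sqrt_dilate_eq hg hW heig s
  rintro s (rfl | rfl | rfl) p hp
  · exact eq_zero_of_dft_two (key 2) p hp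
  · exact eq_zero_of_dft_three (key 3) p hp
  · exact eq_zero_of_dft_four (key 4) p hp
end

section
/- For every m ∈ ℕ ∪ {0} and p ∈ {1,3}, the Hermite function h_{4m+2} satisfies ∑_{k∈ℤ} (−1)^k h_{4m+2}(√2·(k + p/4)) = 0. -/
open MeasureTheory Complex Real FourierTransform

/-- The `n`-th Hermite function `h_n(x) = c_n^{-1/2} e^{π x²} (d/dx)^n e^{-2π x²}`
with `c_n = (2π)^n 2^{n-1/2} n!`. -/
noncomputable def hermiteFun (n : ℕ) (x : ℝ) : ℝ :=
  ((2 * Real.pi) ^ n * (2:ℝ) ^ ((n : ℝ) - 1/2) * (n.factorial : ℝ)) ^ (-(1/2 : ℝ)) *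
    Real.exp (Real.pi * x ^ 2) * iteratedDeriv n (fun t => Real.exp (-2 * Real.pi * t ^ 2)) x

open Asymptotics Filter Polynomial

/-- The product of a real polynomial and the self-dual Gaussian `exp (-π x²)`. -/
noncomputable def polyGaussian (P : ℝ[X]) (x : ℝ) : ℂ :=
  P.eval x * cexp (-π * x ^ 2)

theorem hasDerivAt_polyGaussian (P : ℝ[X]) (x : ℝ) :
    HasDerivAt (polyGaussian P) (polyGaussian (derivative P - C (2 * π) * X * P) x) x := by
  have h1 : HasDerivAt (fun y : ℝ => ((P.eval y : ℝ) : ℂ)) ((P.derivative.eval x : ℝ) : ℂ) x :=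
    (P.hasDerivAt x).ofReal_comp
  have h2 : HasDerivAt (fun y : ℝ => cexp (-π * (y : ℂ) ^ 2))
      (cexp (-π * (x : ℂ) ^ 2) * (-π * (2 * x))) x := by
    have := (((hasDerivAt_id (x : ℂ)).pow 2).const_mul (-π : ℂ)).cexp.comp_ofReal
    simpa using this
  convert! h1.mul h2 using 1
  simp [polyGaussian]
  ring

theorem continuous_polyGaussian (P : ℝ[X]) : Continuous (polyGaussian P) :=
  continuous_iff_continuousAt.mpr fun x => (hasDerivAt_polyGaussian P x).continuousAt

theorem polyGaussian_add (P Q : ℝ[X]) :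
    polyGaussian (P + Q) = fun x => polyGaussian P x + polyGaussian Q x := by
  ext x
  simp [polyGaussian, add_mul]

theorem polyGaussian_C_mul (a : ℝ) (P : ℝ[X]) :
    polyGaussian (C a * P) = fun x => (a : ℂ) * polyGaussian P x := by
  ext x
  simp [polyGaussian, mul_assoc]

theorem polyGaussian_X_pow (n : ℕ) (x : ℝ) :
    polyGaussian (X ^ n) x = (x ^ n : ℝ) * cexp (-π * x ^ 2) := by
  simp [polyGaussian]

theorem integrable_polyGaussian (P : ℝ[X]) : Integrable (polyGaussian P) := by
  induction P using Polynomial.induction_on' with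
  | add P Q hP hQ => rw [polyGaussian_add]; exact hP.add hQ
  | monomial n a =>
    rw [← C_mul_X_pow_eq_monomial, polyGaussian_C_mul]
    refine Integrable.const_mul ?_ _
    have h := (integrable_rpow_mul_exp_neg_mul_sq pi_pos (s := n)
      (by have : (0 : ℝ) ≤ n := n.cast_nonneg
          linarith)).ofReal (𝕜 := ℂ)
    refine h.congr (Eventually.of_forall fun x => ?_)
    simp [polyGaussian_X_pow]

theorem polyGaussian_isBigO_rpow (P : ℝ[X]) (s : ℝ) :
    polyGaussian P =O[cocompact ℝ] fun x => |x| ^ s := by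
  induction P using Polynomial.induction_on' with
  | add P Q hP hQ => rw [polyGaussian_add]; exact hP.add hQ
  | monomial n a =>
    rw [← C_mul_X_pow_eq_monomial, polyGaussian_C_mul]
    refine IsBigO.const_mul_left ?_ _
    have h := (isLittleO_exp_neg_mul_sq_cocompact (a := π) (by simpa using pi_pos) (s - n)).isBigO
    have h' : (fun x : ℝ => ((x ^ n : ℝ) : ℂ)) =O[cocompact ℝ] fun x : ℝ => |x| ^ (n : ℝ) :=
      IsBigO.of_bound 1 (Eventually.of_forall fun x => by simp)
    refine ((h'.mul h).congr_left fun x => (polyGaussian_X_pow n x).symm).congr' .rfl ?_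
    filter_upwards [(tendsto_norm_cocompact_atTop (E := ℝ)).eventually_gt_atTop 0] with x hx
    rw [← Real.rpow_add (Real.norm_eq_abs x ▸ hx), add_sub_cancel]

/-- The unnormalized Hermite polynomials, determined by
`(d/dx)^n exp (-2πx²) = P_n(x) exp (-2πx²)`. -/
noncomputable def gaussianHermite : ℕ → ℝ[X]
  | 0 => 1
  | n + 1 => derivative (gaussianHermite n) - C (4 * π) * X * gaussianHermite n

theorem iteratedDeriv_exp_neg_two_pi_sq (n : ℕ) :
    iteratedDeriv n (fun t => rexp (-2 * π * t ^ 2)) =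
      fun x => (gaussianHermite n).eval x * rexp (-2 * π * x ^ 2) := by
  induction n with
  | zero => simp [gaussianHermite]
  | succ n ih =>
    rw [iteratedDeriv_succ, ih]
    ext x
    have h := ((gaussianHermite n).hasDerivAt x).mul
      (((hasDerivAt_pow 2 x).const_mul (-2 * π)).exp)
    refine h.deriv.trans ?_
    simp [gaussianHermite]
    ring

theorem ofReal_hermiteFun (n : ℕ) : ∃ c : ℝ, ∀ x,
    (hermiteFun n x : ℂ) = c * polyGaussian (gaussianHermite n) x := by
  refine ⟨((2 * π) ^ n * (2 : ℝ) ^ ((n : ℝ) - 1 / 2) * (n.factorial : ℝ)) ^ (-(1 / 2 : ℝ)),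
    fun x => ?_⟩
  have hexp : rexp (π * x ^ 2) * rexp (-2 * π * x ^ 2) = rexp (-π * x ^ 2) := by
    rw [← Real.exp_add]
    ring_nf
  have hpoly : polyGaussian (gaussianHermite n) x =
      ((rexp (-π * x ^ 2) * (gaussianHermite n).eval x : ℝ) : ℂ) := by
    rw [polyGaussian]
    push_cast
    ring
  rw [hermiteFun, iteratedDeriv_exp_neg_two_pi_sq, hpoly, ← hexp, ← ofReal_mul]
  congr 1
  ring

theorem fourier_polyGaussian_raise {P : ℝ[X]} {c : ℂ}
    (h : ∀ w, 𝓕 (polyGaussian P) w = c * polyGaussian P w) (w : ℝ) :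
    𝓕 (polyGaussian (derivative P - C (4 * π) * X * P)) w =
      -I * c * polyGaussian (derivative P - C (4 * π) * X * P) w := by
  have hderiv : deriv (polyGaussian P) = polyGaussian (derivative P - C (2 * π) * X * P) :=
    funext fun x => (hasDerivAt_polyGaussian P x).deriv
  have hX : Integrable fun x : ℝ => x • polyGaussian P x := by
    refine (integrable_polyGaussian (X * P)).congr (Eventually.of_forall fun x => ?_)
    simp [polyGaussian, mul_assoc]
  have h1 := congrFun (Real.fourier_deriv (integrable_polyGaussian P)
    (fun x => (hasDerivAt_polyGaussian P x).differentiableAt)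
    (hderiv ▸ integrable_polyGaussian _)) w
  have h2 := congrFun (Real.deriv_fourier (integrable_polyGaussian P) hX) w
  have h3 : deriv (𝓕 (polyGaussian P)) w =
      c * polyGaussian (derivative P - C (2 * π) * X * P) w := by
    rw [funext h]
    exact ((hasDerivAt_polyGaussian P w).const_mul c).deriv
  have hsplit (x : ℝ) (Q : ℝ[X]) : polyGaussian (Q - C (4 * π) * X * P) x =
      polyGaussian (Q - C (2 * π) * X * P) x - 2 * π * x * polyGaussian P x := by
    simp [polyGaussian]
    ring
  have hfun : polyGaussian (derivative P - C (4 * π) * X * P) =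
      deriv (polyGaussian P) + (-I) • fun x : ℝ => (-2 * π * I * x) • polyGaussian P x := by
    ext x
    rw [hderiv, hsplit]
    simp only [Pi.add_apply, Pi.smul_apply, smul_eq_mul]
    linear_combination (-2 * π * x * polyGaussian P x) * I_sq
  have hint : Integrable fun x : ℝ => (-2 * π * I * x) • polyGaussian P x := by
    refine (hX.const_mul (-2 * π * I)).congr (Eventually.of_forall fun x => ?_)
    simp [mul_assoc]
  have hadd : 𝓕 (polyGaussian (derivative P - C (4 * π) * X * P)) w =
      𝓕 (deriv (polyGaussian P)) w +
        -I * 𝓕 (fun x : ℝ => (-2 * π * I * x) • polyGaussian P x) w := by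
    rw [hfun, Real.fourier_real_eq, Real.fourier_real_eq, Real.fourier_real_eq,
      ← integral_const_mul, ← integral_add]
    · congr 1 with x
      simp only [Pi.add_apply, Pi.smul_apply, Circle.smul_def, smul_eq_mul]
      ring
    · simpa [mul_comm w] using (Real.fourierIntegral_convergent_iff (V := ℝ) w).mpr
        (hderiv ▸ integrable_polyGaussian _ : Integrable (deriv (polyGaussian P)))
    · refine Integrable.const_mul ?_ _
      simpa [mul_comm w] using (Real.fourierIntegral_convergent_iff (V := ℝ) w).mpr hint
  rw [hadd, h1, ← h2, h3, h, hsplit]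
  simp only [smul_eq_mul]
  ring

theorem fourier_polyGaussian_gaussianHermite (n : ℕ) (w : ℝ) :
    𝓕 (polyGaussian (gaussianHermite n)) w = (-I) ^ n * polyGaussian (gaussianHermite n) w := by
  induction n generalizing w with
  | zero =>
    have hf : polyGaussian 1 = fun x : ℝ => cexp (-π * 1 * x ^ 2) := by
      ext x
      simp [polyGaussian]
    rw [gaussianHermite, hf, fourier_gaussian_pi (by simp)]
    simp
  | succ n ih => rw [gaussianHermite, fourier_polyGaussian_raise ih w, pow_succ']

theorem gaussianHermite_eval_neg (n : ℕ) (x : ℝ) :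
    (gaussianHermite n).eval (-x) = (-1) ^ n * (gaussianHermite n).eval x := by
  have h := iteratedDeriv_comp_neg n (fun t : ℝ => rexp (-2 * π * t ^ 2)) (-x)
  simp only [neg_sq, neg_neg, iteratedDeriv_exp_neg_two_pi_sq, smul_eq_mul] at h
  rw [← mul_assoc] at h
  exact mul_right_cancel₀ (Real.exp_pos _).ne' h

theorem isBigO_rpow_neg_two_comp_affine {f : ℝ → ℂ}
    (hf : f =O[cocompact ℝ] fun x => |x| ^ (-2 : ℝ)) {c : ℝ} (hc : c ≠ 0) (d : ℝ) :
    (fun x => f (c * x + d)) =O[cocompact ℝ] fun x => |x| ^ (-2 : ℝ) := by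
  have htend : Tendsto (fun x : ℝ => c * x + d) (cocompact ℝ) (cocompact ℝ) :=
    ((Homeomorph.mulLeft₀ c hc).trans (Homeomorph.addRight d)).isClosedEmbedding.tendsto_cocompact
  refine (hf.comp_tendsto htend).trans ?_
  have hc' : 0 < |c| := abs_pos.mpr hc
  refine IsBigO.of_bound ((|c| / 2) ^ (-2 : ℝ)) ?_
  filter_upwards [(tendsto_norm_cocompact_atTop (E := ℝ)).eventually_ge_atTop
    (2 * |d| / |c| + 1)] with x hx
  rw [Real.norm_eq_abs] at hx
  have hx0 : 0 < |x| := by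
    have : 0 ≤ 2 * |d| / |c| := by positivity
    linarith
  have hlow : |c| / 2 * |x| ≤ |c * x + d| := by
    have h1 : 2 * |d| / |c| ≤ |x| := by linarith
    rw [div_le_iff₀ hc'] at h1
    have h2 := abs_sub_abs_le_abs_sub (c * x) (-d)
    rw [abs_neg, abs_mul, sub_neg_eq_add] at h2
    linarith
  simp only [Function.comp_apply, Real.norm_eq_abs]
  rw [abs_of_nonneg (Real.rpow_nonneg (abs_nonneg _) _),
    abs_of_nonneg (Real.rpow_nonneg (abs_nonneg _) _), ← Real.mul_rpow (by positivity) (by positivity)]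
  exact Real.rpow_le_rpow_of_nonpos (by positivity) hlow (by norm_num)

theorem summable_int_of_isBigO_rpow_neg_two {f : ℝ → ℂ}
    (hf : f =O[cocompact ℝ] fun x => |x| ^ (-2 : ℝ)) : Summable fun n : ℤ => f n :=
  summable_of_isBigO (Real.summable_abs_int_rpow one_lt_two)
    (hf.comp_tendsto Int.tendsto_coe_cofinite)

theorem fourier_modulation_dilation (f : ℝ → ℂ) {c : ℝ} (hc : 0 < c) (b w : ℝ) :
    𝓕 (fun x : ℝ => cexp (-(2 * π * b * x : ℝ) * I) * f (c * x)) w =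
      (c⁻¹ : ℝ) * 𝓕 f (c⁻¹ * (w + b)) := by
  rw [Real.fourier_real_eq_integral_exp_smul, Real.fourier_real_eq_integral_exp_smul]
  have h := Measure.integral_comp_mul_left
    (fun v : ℝ => cexp (↑(-2 * π * v * (c⁻¹ * (w + b))) * I) • f v) c
  rw [abs_of_pos (inv_pos.mpr hc), Complex.real_smul] at h
  rw [← h]
  congr 1 with v
  rw [smul_eq_mul, smul_eq_mul, ← mul_assoc, ← Complex.exp_add]
  congr 2
  have : (c : ℂ) ≠ 0 := by exact_mod_cast hc.ne'
  push_cast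
  field_simp
  ring

theorem tsum_int_eq_tsum_even_add_odd {b : ℤ → ℂ} (hb : Summable b) :
    ∑' n, b n = ∑' k, (b (2 * k) + b (2 * k + 1)) := by
  rw [← (Int.divModEquiv 2).symm.tsum_eq b]
  refine (Summable.tsum_prod ((Int.divModEquiv 2).symm.summable_iff.mpr hb)).trans ?_
  congr 1 with k
  simp [tsum_fintype, Fin.sum_univ_two, Int.divModEquiv, mul_comm]

theorem tsum_alternating_reflect (f : ℝ → ℂ) (heven : ∀ x, f (-x) = f x) (c : ℝ) :
    ∑' k : ℤ, (-1 : ℂ) ^ k * f (c * (k + 3 / 4)) =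
      -∑' k : ℤ, (-1 : ℂ) ^ k * f (c * (k + 1 / 4)) := by
  rw [← (Equiv.subLeft (-1 : ℤ)).tsum_eq, ← tsum_neg]
  congr 1 with k
  have hsign : (-1 : ℂ) ^ (-1 - k) = -(-1) ^ k := by
    rw [zpow_sub₀ (by norm_num), ← inv_zpow', ← one_div]
    rcases Int.even_or_odd k with h | h <;> simp [h.neg_one_zpow]
  rw [Equiv.subLeft_apply, hsign, ← heven, neg_mul]
  congr 3
  push_cast
  ring

theorem tsum_alternating_eq_zero_of_fourier_eq_neg {f : ℝ → ℂ} (hcont : Continuous f)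
    (heven : ∀ x, f (-x) = f x) (hF : ∀ w, 𝓕 f w = -f w)
    (hf : f =O[cocompact ℝ] fun x => |x| ^ (-2 : ℝ)) :
    ∑' k : ℤ, (-1 : ℂ) ^ k * f (√2 * (k + 1 / 4)) = 0 := by
  have h2 : (0 : ℝ) < √2 := by positivity
  have hsq : (√2)⁻¹ = √2 / 2 := by rw [inv_eq_one_div, Real.sqrt_div_self'.symm]
  set S := ∑' k : ℤ, (-1 : ℂ) ^ k * f (√2 * (k + 1 / 4)) with hS
  set F : ℝ → ℂ := fun x => cexp (-(2 * π * (1 / 2 : ℝ) * x : ℝ) * I) * f (√2 * x) with hFdef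
  have hFF (w : ℝ) : 𝓕 F w = -((√2)⁻¹ : ℝ) * f ((√2)⁻¹ * w + (√2)⁻¹ * (1 / 2)) := by
    rw [hFdef, fourier_modulation_dilation f h2, hF, mul_add]
    ring
  have hFO : F =O[cocompact ℝ] fun x => |x| ^ (-2 : ℝ) := by
    refine IsBigO.trans (IsBigO.of_bound 1 (Eventually.of_forall fun x => ?_))
      (isBigO_rpow_neg_two_comp_affine hf h2.ne' 0)
    rw [hFdef, norm_mul, ← ofReal_neg, norm_exp_ofReal_mul_I, add_zero]
  have hFFO : 𝓕 F =O[cocompact ℝ] fun x => |x| ^ (-2 : ℝ) := by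
    rw [funext hFF]
    exact (isBigO_rpow_neg_two_comp_affine hf (inv_ne_zero h2.ne') _).const_mul_left _
  have hFcont : Continuous F := by fun_prop
  have key := Real.tsum_eq_tsum_fourier_of_rpow_decay hFcont one_lt_two hFO hFFO (1 / 4)
  have hsgn (k : ℤ) : cexp (π * I * k) = (-1) ^ k := by
    rw [mul_comm, Complex.exp_int_mul, exp_pi_mul_I]
  have hsumm (p : ℝ) : Summable fun k : ℤ => (-1 : ℂ) ^ k * f (√2 * (k + p)) := by
    have := summable_int_of_isBigO_rpow_neg_two
      (isBigO_rpow_neg_two_comp_affine hf h2.ne' (√2 * p))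
    refine Summable.of_norm (this.norm.congr fun k => ?_)
    rw [norm_mul, norm_zpow, norm_neg, norm_one, one_zpow, one_mul, mul_add]
  have hL : ∑' n : ℤ, F (1 / 4 + n) = cexp (-(π / 4 * I)) * S := by
    rw [hS, ← tsum_mul_left]
    congr 1 with k
    have hsgn_neg : cexp (-(π * I * k)) = (-1) ^ k := by
      rw [Complex.exp_neg, hsgn, ← inv_zpow, inv_neg, inv_one]
    simp only [hFdef]
    rw [← hsgn_neg, ← mul_assoc, ← Complex.exp_add, add_comm (1 / 4 : ℝ)]
    congr 2
    push_cast
    ring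
  have hR : ∑' n : ℤ, 𝓕 F n * fourier n ((1 / 4 : ℝ) : UnitAddCircle) =
      -((√2)⁻¹ : ℝ) * ((1 - I) * S) := by
    have hs : Summable fun n : ℤ => 𝓕 F n * fourier n ((1 / 4 : ℝ) : UnitAddCircle) := by
      refine Summable.of_norm ((summable_int_of_isBigO_rpow_neg_two hFFO).norm.congr fun n => ?_)
      rw [norm_mul, fourier_apply, Circle.norm_coe, mul_one]
    have hterm (k : ℤ) : 𝓕 F (2 * k : ℤ) * fourier (2 * k) ((1 / 4 : ℝ) : UnitAddCircle) +
        𝓕 F (2 * k + 1 : ℤ) * fourier (2 * k + 1) ((1 / 4 : ℝ) : UnitAddCircle) =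
        -((√2)⁻¹ : ℝ) * ((-1 : ℂ) ^ k * f (√2 * (k + 1 / 4)) +
          I * ((-1 : ℂ) ^ k * f (√2 * (k + 3 / 4)))) := by
      have e1 : fourier (2 * k) ((1 / 4 : ℝ) : UnitAddCircle) = (-1 : ℂ) ^ k := by
        rw [fourier_coe_apply, ← hsgn]
        congr 1
        push_cast
        ring
      have e2 : fourier (2 * k + 1) ((1 / 4 : ℝ) : UnitAddCircle) = I * (-1 : ℂ) ^ k := by
        rw [fourier_coe_apply, ← hsgn]
        nth_rewrite 2 [← Complex.exp_pi_div_two_mul_I]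
        rw [← Complex.exp_add]
        congr 1
        push_cast
        ring
      rw [e1, e2, hFF, hFF,
        show (√2)⁻¹ * ((2 * k : ℤ) : ℝ) + (√2)⁻¹ * (1 / 2) = √2 * (k + 1 / 4) by
          rw [hsq]; push_cast; ring,
        show (√2)⁻¹ * ((2 * k + 1 : ℤ) : ℝ) + (√2)⁻¹ * (1 / 2) = √2 * (k + 3 / 4) by
          rw [hsq]; push_cast; ring]
      ring
    rw [tsum_int_eq_tsum_even_add_odd hs, tsum_congr hterm, tsum_mul_left,
      (hsumm _).tsum_add ((hsumm _).mul_left I), tsum_mul_left, tsum_alternating_reflect f heven, ← hS]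
    ring
  have hphase : cexp (-(π / 4 * I)) = ((√2)⁻¹ : ℝ) * (1 - I) := by
    rw [← neg_mul, Complex.exp_mul_I, Complex.cos_neg, Complex.sin_neg,
      show (π / 4 : ℂ) = ((π / 4 : ℝ) : ℂ) by push_cast; ring, ← Complex.ofReal_cos,
      ← Complex.ofReal_sin, Real.cos_pi_div_four, Real.sin_pi_div_four, hsq]
    ring
  have hzero : cexp (-(π / 4 * I)) * S = 0 := by
    refine self_eq_neg.mp ((hL.symm.trans (key.trans hR)).trans ?_)
    rw [hphase]
    ring
  exact (mul_eq_zero.mp hzero).resolve_left (Complex.exp_ne_zero _)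

theorem hermite_4m2_sum_sqrt2 (m : ℕ) :
    ∀ p ∈ ({1, 3} : Set ℕ),
      ∑' k : ℤ, (-1 : ℝ) ^ k * hermiteFun (4 * m + 2) (Real.sqrt 2 * ((k : ℝ) + (p : ℝ) / 4)) = 0 := by
  obtain ⟨c, hc⟩ := ofReal_hermiteFun (4 * m + 2)
  set f := polyGaussian (gaussianHermite (4 * m + 2)) with hf
  have heven (x : ℝ) : f (-x) = f x := by
    have hpow : (-1 : ℝ) ^ (4 * m + 2) = 1 := Even.neg_one_pow ⟨2 * m + 1, by ring⟩
    simp [hf, polyGaussian, gaussianHermite_eval_neg, hpow]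
  have hF (w : ℝ) : 𝓕 f w = -f w := by
    have hpow : (-I) ^ (4 * m + 2) = -1 := by
      rw [pow_add, pow_mul, Even.neg_pow (by decide), I_pow_four]
      simp
    rw [hf, fourier_polyGaussian_gaussianHermite, hpow, neg_one_mul]
  have hone := tsum_alternating_eq_zero_of_fourier_eq_neg (continuous_polyGaussian _) heven hF
    (polyGaussian_isBigO_rpow _ _)
  have hsum (q : ℝ) (hq : ∑' k : ℤ, (-1 : ℂ) ^ k * f (√2 * (k + q)) = 0) :
      ∑' k : ℤ, (-1 : ℝ) ^ k * hermiteFun (4 * m + 2) (√2 * (k + q)) = 0 := by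
    rw [← ofReal_inj, ofReal_tsum, ofReal_zero, ← mul_zero (c : ℂ), ← hq, ← tsum_mul_left]
    congr 1 with k
    push_cast
    rw [hc]
    ring
  rintro p (rfl | rfl)
  · exact hsum _ (by exact_mod_cast hone)
  · refine hsum _ ?_
    have hthree := tsum_alternating_reflect f heven √2
    rw [hone, neg_zero] at hthree
    exact_mod_cast hthree
end

section
/- ∑_{k∈ℤ} (−1)^k (8π(k + 1/4)² − 1) e^{−2π(k + 1/4)²} = 0. -/
open MeasureTheory Complex Real FourierTransform

/-- A series over `ℤ` can be summed by splitting it into its even and odd terms. -/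
theorem HasSum.int_even_add_odd {f : ℤ → ℝ} {a b : ℝ}
    (he : HasSum (fun k : ℤ => f (2 * k)) a) (ho : HasSum (fun k : ℤ => f (2 * k + 1)) b) :
    HasSum f (a + b) := by
  have h2 : Function.Injective (fun k : ℤ => 2 * k) := fun x y h => by simpa using h
  have h2' : Function.Injective (fun k : ℤ => 2 * k + 1) := fun x y h => by simpa using h
  refine HasSum.add_isCompl ?_ (h2.hasSum_range_iff.2 he) (h2'.hasSum_range_iff.2 ho)
  have hr : Set.range (fun k : ℤ => 2 * k) = {n : ℤ | Even n} := by
    ext n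
    simp [even_iff_exists_two_mul]
  have hr' : Set.range (fun k : ℤ => 2 * k + 1) = {n : ℤ | Odd n} := by
    ext n
    simp [Odd]
  rw [hr, hr']
  exact Int.isCompl_even_odd

/-- The general term of the alternating theta series shifted by `1/4`. -/
noncomputable def altThetaTerm (k : ℤ) (t : ℝ) : ℝ :=
  (-1 : ℝ) ^ k * Real.exp (-2 * Real.pi * t * ((k : ℝ) + 1/4) ^ 2)

/-- The alternating theta series `∑_{k∈ℤ} (-1)^k e^{-2πt(k+1/4)²}`. -/
noncomputable def altTheta (t : ℝ) : ℝ := ∑' k : ℤ, altThetaTerm k t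

theorem exp_neg_shifted_sq_le {t : ℝ} (ht : 0 < t) (k : ℤ) :
    Real.exp (-2 * Real.pi * t * ((k : ℝ) + 1/4) ^ 2) ≤
      Real.exp (-Real.pi * (2 * t * (k : ℝ) ^ 2 - 2 * (t / 2) * |k|)) := by
  apply Real.exp_le_exp.2
  push_cast
  have hk : 0 ≤ Real.pi * t * (|(k : ℝ)| + k + 1 / 8) :=
    mul_nonneg (by positivity) (by linarith [neg_abs_le (k : ℝ)])
  linarith

theorem summable_altThetaTerm {t : ℝ} (ht : 0 < t) : Summable (altThetaTerm · t) := by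
  have h := summable_pow_mul_jacobiTheta₂_term_bound (t / 2) (mul_pos two_pos ht) 0
  refine .of_norm_bounded h fun k => ?_
  simpa [altThetaTerm, abs_mul, abs_zpow] using exp_neg_shifted_sq_le ht k

theorem summable_sq_mul_exp_neg_shifted_sq {t : ℝ} (ht : 0 < t) :
    Summable fun k : ℤ =>
      ((k : ℝ) + 1/4) ^ 2 * Real.exp (-2 * Real.pi * t * ((k : ℝ) + 1/4) ^ 2) := by
  have h0 := summable_pow_mul_jacobiTheta₂_term_bound (t / 2) (mul_pos two_pos ht) 0
  have h2 := summable_pow_mul_jacobiTheta₂_term_bound (t / 2) (mul_pos two_pos ht) 2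
  refine .of_nonneg_of_le (fun k => by positivity) (fun k => ?_) ((h0.add h2).mul_left 2)
  calc _ ≤ (2 * (1 + (k : ℝ) ^ 2)) *
        Real.exp (-Real.pi * (2 * t * (k : ℝ) ^ 2 - 2 * (t / 2) * |k|)) :=
        mul_le_mul (by nlinarith [sq_nonneg ((k : ℝ) - 1/4)]) (exp_neg_shifted_sq_le ht k)
          (by positivity) (by positivity)
    _ = _ := by
        push_cast
        rw [sq_abs]
        ring

theorem hasSum_altTheta_evenKernel {t : ℝ} (ht : 0 < t) :
    HasSum (altThetaTerm · t)
      (HurwitzZeta.evenKernel ((1/8 : ℝ) : UnitAddCircle) (8 * t) -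
        HurwitzZeta.evenKernel ((5/8 : ℝ) : UnitAddCircle) (8 * t)) := by
  have h8 : 0 < 8 * t := by positivity
  rw [sub_eq_add_neg]
  apply HasSum.int_even_add_odd
  · convert! HurwitzZeta.hasSum_int_evenKernel (1/8) h8 using 2 with k
    rw [altThetaTerm, (even_two_mul k).neg_one_zpow, one_mul]
    push_cast
    ring_nf
  · convert! (HurwitzZeta.hasSum_int_evenKernel (5/8) h8).neg using 2 with k
    rw [altThetaTerm, (odd_two_mul_add_one k).neg_one_zpow, neg_one_mul]
    push_cast
    ring_nf

theorem hasSum_cos_cosKernel (a : ℝ) {t : ℝ} (ht : 0 < t) :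
    HasSum (fun n : ℤ => Real.cos (2 * Real.pi * a * n) * Real.exp (-Real.pi * n ^ 2 * t))
      (HurwitzZeta.cosKernel a t) := by
  convert! Complex.hasSum_re (HurwitzZeta.hasSum_int_cosKernel a ht) using 2 with n
  rw [Complex.re_mul_ofReal,
    show 2 * (Real.pi : ℂ) * Complex.I * a * n = ((2 * Real.pi * a * n : ℝ) : ℂ) * Complex.I by
      push_cast; ring, Complex.exp_ofReal_mul_I_re]

theorem hasSum_cos_odd {t : ℝ} (ht : 0 < t) :
    HasSum (fun k : ℤ => 2 * Real.cos ((2 * k + 1) * (Real.pi / 4)) *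
      Real.exp (-Real.pi * (2 * k + 1) ^ 2 * (t / 8))) (2 * √2 * altTheta t) := by
  have hG : HasSum (altThetaTerm · t) (altTheta t) := (summable_altThetaTerm ht).hasSum
  rw [show 2 * √2 * altTheta t = √2 * altTheta t + √2 * altTheta t by ring]
  apply HasSum.int_even_add_odd
  · convert! hG.mul_left √2 using 2 with k
    rw [altThetaTerm, show (2 * ((2 * k : ℤ) : ℝ) + 1) * (Real.pi / 4)
      = Real.pi / 4 + k * Real.pi by push_cast; ring, Real.cos_add_int_mul_pi,
      Real.cos_pi_div_four]
    push_cast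
    ring_nf
  · convert! ((Equiv.subLeft (-1 : ℤ)).hasSum_iff.2 hG).mul_left √2 using 2 with k
    have hs : (-1 : ℝ) ^ (-1 - k) = -(-1) ^ k := by
      rw [zpow_sub₀ (by norm_num), div_eq_mul_inv, ← inv_zpow]
      norm_num
    rw [show (2 * ((2 * k + 1 : ℤ) : ℝ) + 1) * (Real.pi / 4)
      = (Real.pi - Real.pi / 4) + k * Real.pi by push_cast; ring, Real.cos_add_int_mul_pi,
      Real.cos_pi_sub, Real.cos_pi_div_four]
    simp only [Function.comp_apply, Equiv.subLeft_apply, altThetaTerm, hs]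
    push_cast
    ring_nf

theorem cosKernel_sub_cosKernel {t : ℝ} (ht : 0 < t) :
    HurwitzZeta.cosKernel ((1/8 : ℝ) : UnitAddCircle) (t / 8) -
      HurwitzZeta.cosKernel ((5/8 : ℝ) : UnitAddCircle) (t / 8) = 2 * √2 * altTheta t := by
  have h8 : 0 < t / 8 := by positivity
  refine ((hasSum_cos_cosKernel (1/8) h8).sub (hasSum_cos_cosKernel (5/8) h8)).unique ?_
  rw [← zero_add (2 * √2 * altTheta t)]
  apply HasSum.int_even_add_odd
  · convert! (hasSum_zero : HasSum (fun _ : ℤ => (0 : ℝ)) 0) using 2 with k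
    rw [show 2 * Real.pi * (5/8) * ((2 * k : ℤ) : ℝ)
      = 2 * Real.pi * (1/8) * ((2 * k : ℤ) : ℝ) + k * (2 * Real.pi) by push_cast; ring,
      Real.cos_add_int_mul_two_pi, sub_self]
  · convert! hasSum_cos_odd ht using 2 with k
    rw [show 2 * Real.pi * (5/8) * ((2 * k + 1 : ℤ) : ℝ)
      = (2 * k + 1) * (Real.pi / 4) + (2 * k + 1 : ℤ) * Real.pi by push_cast; ring,
      Real.cos_add_int_mul_pi, (odd_two_mul_add_one k).neg_one_zpow,
      show 2 * Real.pi * (1/8) * ((2 * k + 1 : ℤ) : ℝ)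
      = (2 * k + 1) * (Real.pi / 4) by push_cast; ring]
    push_cast
    ring

theorem altTheta_functional_equation {t : ℝ} (ht : 0 < t) :
    √t * altTheta t = altTheta t⁻¹ := by
  have h := cosKernel_sub_cosKernel (inv_pos.2 ht)
  have h8 : √(8 * t) = 2 * √2 * √t := by
    rw [show 8 * t = 2 ^ 2 * (2 * t) by ring, Real.sqrt_mul (by norm_num),
      Real.sqrt_sq two_pos.le, Real.sqrt_mul two_pos.le, mul_assoc]
  rw [altTheta, (hasSum_altTheta_evenKernel ht).tsum_eq,
    HurwitzZeta.evenKernel_functional_equation, HurwitzZeta.evenKernel_functional_equation,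
    ← mul_sub, show 1 / (8 * t) = t⁻¹ / 8 by field_simp, h, ← Real.sqrt_eq_rpow, h8]
  have := Real.sqrt_pos.2 ht
  field_simp

theorem hasDerivAt_altTheta_one :
    HasDerivAt altTheta
      (∑' k : ℤ, (-1 : ℝ) ^ k * (-2 * Real.pi * ((k : ℝ) + 1/4) ^ 2) *
        Real.exp (-2 * Real.pi * ((k : ℝ) + 1/4) ^ 2)) 1 := by
  have h := hasDerivAt_tsum_of_isPreconnected (𝕜 := ℝ) (g := altThetaTerm)
    (g' := fun k t => (-1 : ℝ) ^ k * (-2 * Real.pi * ((k : ℝ) + 1/4) ^ 2) *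
        Real.exp (-2 * Real.pi * t * ((k : ℝ) + 1/4) ^ 2))
    (t := Set.Ioi (1/2)) (y₀ := 1) (y := 1)
    ((summable_sq_mul_exp_neg_shifted_sq one_half_pos).mul_left (2 * Real.pi))
    isOpen_Ioi isPreconnected_Ioi ?_ ?_ (by norm_num) (summable_altThetaTerm one_pos)
    (by norm_num)
  · simp only [mul_one] at h
    exact h
  · intro k t _
    have h1 : HasDerivAt (fun t : ℝ => -2 * Real.pi * t * ((k : ℝ) + 1/4) ^ 2)
        (-2 * Real.pi * 1 * ((k : ℝ) + 1/4) ^ 2) t :=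
      ((hasDerivAt_id' t).const_mul _).mul_const _
    convert! h1.exp.const_mul ((-1 : ℝ) ^ k) using 1
    ring
  · intro k t ht
    have hexp : Real.exp (-2 * Real.pi * t * ((k : ℝ) + 1/4) ^ 2) ≤
        Real.exp (-2 * Real.pi * (1/2) * ((k : ℝ) + 1/4) ^ 2) := by
      apply Real.exp_le_exp.2
      have : 0 ≤ Real.pi * ((k : ℝ) + 1/4) ^ 2 * (t - 1/2) :=
        mul_nonneg (by positivity) (sub_nonneg.2 (le_of_lt ht))
      linarith
    have hn : ‖(-1 : ℝ) ^ k * (-2 * Real.pi * ((k : ℝ) + 1/4) ^ 2)‖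
        = 2 * Real.pi * ((k : ℝ) + 1/4) ^ 2 := by
      rw [norm_mul, norm_zpow, norm_neg, norm_one, one_zpow, one_mul, neg_mul, neg_mul, norm_neg,
        Real.norm_of_nonneg (by positivity)]
    rw [norm_mul, hn, Real.norm_of_nonneg (Real.exp_pos _).le, ← mul_assoc]
    exact mul_le_mul_of_nonneg_left hexp (by positivity)

theorem deriv_altTheta_one : 4 * deriv altTheta 1 + altTheta 1 = 0 := by
  have hd : HasDerivAt altTheta (deriv altTheta 1) 1 :=
    hasDerivAt_altTheta_one.differentiableAt.hasDerivAt
  have hl := (Real.hasDerivAt_sqrt one_ne_zero).mul hd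
  have hr : HasDerivAt (fun t : ℝ => altTheta t⁻¹) (deriv altTheta 1 * (-((1 : ℝ) ^ 2)⁻¹)) 1 := by
    refine HasDerivAt.comp (h₂ := altTheta) (1 : ℝ) ?_ (hasDerivAt_inv one_ne_zero)
    rwa [inv_one]
  have he : (fun t : ℝ => altTheta t⁻¹) =ᶠ[nhds 1] fun t => √t * altTheta t := by
    filter_upwards [lt_mem_nhds one_pos] with t ht
    exact (altTheta_functional_equation ht).symm
  have := hl.unique (hr.congr_of_eventuallyEq he.symm)
  norm_num at this
  linarith

theorem hermite_two_identity :
    ∑' k : ℤ, (-1 : ℝ) ^ k * (8 * Real.pi * ((k : ℝ) + 1/4) ^ 2 - 1) *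
      Real.exp (-2 * Real.pi * ((k : ℝ) + 1/4) ^ 2) = 0 := by
  have hs : Summable fun k : ℤ => (-1 : ℝ) ^ k * (-2 * Real.pi * ((k : ℝ) + 1/4) ^ 2) *
        Real.exp (-2 * Real.pi * ((k : ℝ) + 1/4) ^ 2) := by
    refine .of_norm_bounded
      ((summable_sq_mul_exp_neg_shifted_sq one_pos).mul_left (2 * Real.pi)) fun k => ?_
    apply le_of_eq
    simp [abs_of_pos Real.pi_pos]
    ring
  have h := deriv_altTheta_one
  rw [hasDerivAt_altTheta_one.deriv, altTheta, ← tsum_mul_left,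
    ← (hs.mul_left 4).tsum_add (summable_altThetaTerm one_pos)] at h
  rw [← neg_eq_zero, ← tsum_neg, ← h]
  refine tsum_congr fun k => ?_
  rw [altThetaTerm, mul_one]
  ring
end
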